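/- arXiv:math/9907205 — 2 statements merged into one kernel-verified Lean document; each statement's English description precedes it below -/
import Mathlib

section
/- Let X be a compact metric space, f : X → X a continuous map, and B : X → ℝ a continuous function. Suppose that for every integer n ≥ 1 there exists x ∈ X with Σ_{ℓ=0}^{n−1} B(f^ℓ(x)) ≥ 0. Then there exists an f-invariant Borel probability measure μ on X with ∫ B dμ ≥ 0, and there exists a point p ∈ X such that the limit lim_{n→∞} (1/n) Σ_{ℓ=0}^{n−1} B(f^ℓ(p)) exists and is ≥ 0. -/
open Filter Topology MeasureTheory

/-- If for every length some orbit segment has Birkhoff sum at least `c * n`, then a single point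
has all its Birkhoff sums at least `c * n`. -/
theorem exists_point_birkhoffSum_ge {X : Type*} [MetricSpace X] [CompactSpace X]
    (f : X → X) (hf : Continuous f) (B : X → ℝ) (hB : Continuous B) (c : ℝ)
    (h : ∀ n : ℕ, ∃ x : X, c * n ≤ birkhoffSum f B n x) :
    ∃ p : X, ∀ n : ℕ, c * n ≤ birkhoffSum f B n p := by
  have hcont : ∀ n, Continuous (birkhoffSum f B n) := fun n => by
    unfold birkhoffSum
    exact continuous_finsetSum _ fun i _ => hB.comp (hf.iterate i)
  obtain ⟨K, hK⟩ : ∃ K : ℝ, ∀ x, |B x| ≤ K := by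
    obtain ⟨K, hK⟩ := isCompact_univ.exists_bound_of_continuousOn hB.continuousOn
    exact ⟨K, fun x => hK x trivial⟩
  have hK0 : 0 ≤ K := by
    obtain ⟨x, -⟩ := h 0
    exact (abs_nonneg _).trans (hK x)
  have hS : ∀ n x, birkhoffSum f B n x ≤ n * K := fun n x => by
    unfold birkhoffSum
    refine (Finset.sum_le_card_nsmul _ _ K fun i _ => (le_abs_self _).trans (hK _)).trans ?_
    simp
  -- points that are good for a bounded time
  have key : ∀ (N : ℕ) (ε : ℝ), 0 < ε →
      ∃ x : X, ∀ n : ℕ, 1 ≤ n → n ≤ N → (c - ε) * n ≤ birkhoffSum f B n x := by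
    intro N ε hε
    by_contra! hcon
    have bound : ∀ M : ℕ, ∀ x, birkhoffSum f B M x ≤ N * (K + |c - ε|) + (c - ε) * M := by
      intro M
      induction M using Nat.strong_induction_on with
      | _ M ih =>
        intro x
        obtain ⟨n, hn1, hnN, hn⟩ := hcon x
        by_cases hM : M < n
        · have h1 := hS M x
          have h2 : (M : ℝ) ≤ N := by exact_mod_cast (hM.le.trans hnN)
          have h3 : -((c - ε) * M) ≤ |c - ε| * N := by
            have := neg_abs_le (c - ε)
            have := mul_le_mul_of_nonneg_left h2 (abs_nonneg (c - ε))
            nlinarith [Nat.cast_nonneg (α := ℝ) M]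
          have h4 := mul_le_mul_of_nonneg_right h2 hK0
          linarith
        · obtain ⟨m, rfl⟩ := Nat.exists_eq_add_of_le (not_lt.1 hM)
          rw [birkhoffSum_add]
          have := ih m (by omega) (f^[n] x)
          push_cast
          linarith
    obtain ⟨M, hM⟩ := exists_nat_gt ((N * (K + |c - ε|)) / ε)
    obtain ⟨x, hx⟩ := h M
    have := bound M x
    rw [div_lt_iff₀ hε] at hM
    linarith
  let t : ℕ → Set X := fun k =>
    {x | ∀ n : ℕ, 1 ≤ n → n ≤ k → (c - 1 / ((k : ℝ) + 1)) * n ≤ birkhoffSum f B n x}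
  have ht : (⋂ k, t k).Nonempty := by
    have hcl : ∀ k, IsClosed (t k) := fun k => by
      simp only [t, Set.setOf_forall]
      exact isClosed_iInter fun n => isClosed_iInter fun _ => isClosed_iInter fun _ =>
        isClosed_le continuous_const (hcont n)
    refine IsCompact.nonempty_iInter_of_sequence_nonempty_isCompact_isClosed t ?_ ?_
      (hcl 0).isCompact hcl
    · intro k x hx n hn1 hnk
      refine le_trans ?_ (hx n hn1 (by omega))
      gcongr
      push_cast
      linarith
    · intro k
      exact key k _ (by positivity)
  obtain ⟨p, hp⟩ := ht
  refine ⟨p, fun n => ?_⟩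
  rcases Nat.eq_zero_or_pos n with rfl | hn
  · simp
  have hlim : Tendsto (fun k : ℕ => (c - 1 / ((k : ℝ) + 1)) * n) atTop (𝓝 ((c - 0) * n)) :=
    (tendsto_const_nhds.sub tendsto_one_div_add_atTop_nhds_zero_nat).mul_const _
  rw [sub_zero] at hlim
  refine le_of_tendsto hlim ?_
  filter_upwards [eventually_ge_atTop n] with k hk
  exact Set.mem_iInter.1 hp k n hn hk

/-- A point with convergent Birkhoff averages. -/
theorem exists_point_tendsto {X : Type*} [MetricSpace X] [CompactSpace X]
    (f : X → X) (hf : Continuous f) (B : X → ℝ) (hB : Continuous B)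
    (h : ∀ n : ℕ, 1 ≤ n → ∃ x : X, 0 ≤ birkhoffSum f B n x) :
    ∃ p : X, ∃ L : ℝ, 0 ≤ L ∧ Tendsto (fun n => birkhoffAverage ℝ f B n p) atTop (𝓝 L) := by
  have hne : Nonempty X := (h 1 le_rfl).nonempty
  have hcont : ∀ n, Continuous (birkhoffSum f B n) := fun n => by
    unfold birkhoffSum
    exact continuous_finsetSum _ fun i _ => hB.comp (hf.iterate i)
  have hmax : ∀ n, ∃ x, ∀ y, birkhoffSum f B n y ≤ birkhoffSum f B n x := fun n => by
    obtain ⟨x, -, hx⟩ := isCompact_univ.exists_isMaxOn Set.univ_nonempty (hcont n).continuousOn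
    exact ⟨x, fun y => hx (Set.mem_univ y)⟩
  choose z hz using hmax
  let a : ℕ → ℝ := fun n => birkhoffSum f B n (z n)
  have ha : Subadditive a := fun m n => by
    change birkhoffSum f B (m + n) _ ≤ _
    rw [birkhoffSum_add]
    exact add_le_add (hz m _) (hz n _)
  have ha0 : ∀ n, 0 ≤ a n := fun n => by
    rcases Nat.eq_zero_or_pos n with rfl | hn
    · simp [a]
    · obtain ⟨x, hx⟩ := h n hn
      exact hx.trans (hz n x)
  have hbdd : BddBelow (Set.range fun n => a n / n) :=
    ⟨0, by rintro _ ⟨n, rfl⟩; exact div_nonneg (ha0 n) n.cast_nonneg⟩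
  have hlim := ha.tendsto_lim hbdd
  obtain ⟨p, hp⟩ := exists_point_birkhoffSum_ge f hf B hB ha.lim fun n => ⟨z n, by
    rcases Nat.eq_zero_or_pos n with rfl | hn
    · simp
    · have := ha.lim_le_div hbdd hn.ne'
      rwa [le_div_iff₀ (by exact_mod_cast hn)] at this⟩
  refine ⟨p, ha.lim, ge_of_tendsto' hlim fun n => div_nonneg (ha0 n) n.cast_nonneg, ?_⟩
  refine tendsto_of_tendsto_of_tendsto_of_le_of_le' tendsto_const_nhds hlim ?_ ?_
  · filter_upwards [eventually_gt_atTop 0] with n hn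
    have hn' : (0 : ℝ) < n := by exact_mod_cast hn
    rw [birkhoffAverage, smul_eq_mul, inv_mul_eq_div, le_div_iff₀ hn']
    exact hp n
  · filter_upwards with n
    rw [birkhoffAverage, smul_eq_mul, inv_mul_eq_div]
    exact div_le_div_of_nonneg_right (hz n p) n.cast_nonneg

/-- Krylov-Bogolyubov along the orbit of a point. -/
theorem exists_invariant_of_tendsto {X : Type*} [MetricSpace X] [CompactSpace X]
    [MeasurableSpace X] [BorelSpace X]
    (f : X → X) (hf : Continuous f) (B : X → ℝ) (hB : Continuous B) (p : X) (L : ℝ)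
    (hL : Tendsto (fun n => birkhoffAverage ℝ f B n p) atTop (𝓝 L)) :
    ∃ μ : Measure X, IsProbabilityMeasure μ ∧
        (∀ S : Set X, MeasurableSet S → μ (f ⁻¹' S) = μ S) ∧ ∫ x, B x ∂μ = L := by
  let m : ℕ → Measure X := fun n =>
    ((n + 1 : ℕ) : ENNReal)⁻¹ • ∑ l ∈ Finset.range (n + 1), Measure.dirac (f^[l] p)
  have hm : ∀ n, IsProbabilityMeasure (m n) := fun n => ⟨by
    simp only [m, Measure.smul_apply, Measure.coe_finsetSum, Finset.sum_apply, measure_univ,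
      Finset.sum_const, Finset.card_range, smul_eq_mul, nsmul_eq_mul, mul_one]
    exact ENNReal.inv_mul_cancel (by simp) (ENNReal.natCast_ne_top _)⟩
  have hint : ∀ n (g : X → ℝ), Continuous g →
      ∫ x, g x ∂(m n) = birkhoffAverage ℝ f g (n + 1) p := by
    intro n g hg
    simp only [m]
    rw [integral_smul_measure, integral_finsetSum_measure]
    · simp only [integral_dirac, birkhoffAverage, birkhoffSum]
      rw [ENNReal.toReal_inv, ENNReal.toReal_natCast]
    · intro i _
      exact integrable_dirac (by simp)
  let ν : ℕ → ProbabilityMeasure X := fun n => ⟨m n, hm n⟩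
  let U : Ultrafilter ℕ := hyperfilter ℕ
  have hU : (U : Filter ℕ) ≤ atTop := Nat.hyperfilter_le_atTop
  obtain ⟨μ, hμ⟩ : ∃ μ : ProbabilityMeasure X, Tendsto ν U (𝓝 μ) :=
    ⟨(U.map ν).lim, (U.map ν).le_nhds_lim⟩
  rw [ProbabilityMeasure.tendsto_iff_forall_integral_tendsto] at hμ
  have hμ' : ∀ g : X → ℝ, Continuous g →
      Tendsto (fun n => birkhoffAverage ℝ f g (n + 1) p) U (𝓝 (∫ x, g x ∂(μ : Measure X))) := by
    intro g hg
    refine (hμ (BoundedContinuousFunction.mkOfCompact ⟨g, hg⟩)).congr fun n => ?_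
    exact hint n g hg
  refine ⟨μ, inferInstance, ?_, ?_⟩
  · have hmap : (μ : Measure X).map f = μ := by
      have : IsProbabilityMeasure ((μ : Measure X).map f) :=
        Measure.isProbabilityMeasure_map hf.measurable.aemeasurable
      refine ext_of_forall_integral_eq_of_IsFiniteMeasure fun g => ?_
      rw [integral_map hf.measurable.aemeasurable g.continuous.aestronglyMeasurable]
      have h1 := hμ' _ (g.continuous.comp hf)
      have h2 := hμ' _ g.continuous
      have h3 := ((tendsto_birkhoffAverage_apply_sub_birkhoffAverage' ℝ
        (g := g) g.isBounded_range f p).comp (tendsto_add_atTop_nat 1)).mono_left hU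
      have h4 := (h1.sub h2)
      have h5 := tendsto_nhds_unique (h4.congr fun n => ?_) h3
      · exact sub_eq_zero.1 h5
      · simp only [birkhoffAverage, birkhoffSum, Function.comp,
          ← Function.iterate_succ_apply, ← Function.iterate_succ_apply']
    intro S hS
    rw [← Measure.map_apply hf.measurable hS, hmap]
  · exact tendsto_nhds_unique (hμ' B hB) ((hL.comp (tendsto_add_atTop_nat 1)).mono_left hU)

/-- Measure-theoretic engine: if Birkhoff sums of a continuous function `B` are
nonnegative at some point for every length `n`, then there is an `f`-invariant Borel
probability measure with `∫ B dμ ≥ 0`, and a point whose Birkhoff averages of `B`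
converge to a nonnegative limit. -/
theorem exists_invariant_measure_and_point {X : Type*} [MetricSpace X] [CompactSpace X]
    [MeasurableSpace X] [BorelSpace X]
    (f : X → X) (hf : Continuous f) (B : X → ℝ) (hB : Continuous B)
    (h : ∀ n : ℕ, 1 ≤ n → ∃ x : X, 0 ≤ ∑ l ∈ Finset.range n, B (f^[l] x)) :
    (∃ μ : Measure X, IsProbabilityMeasure μ ∧
        (∀ S : Set X, MeasurableSet S → μ (f ⁻¹' S) = μ S) ∧
        0 ≤ ∫ x, B x ∂μ) ∧
      ∃ p : X, ∃ L : ℝ, 0 ≤ L ∧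
        Filter.Tendsto (fun n : ℕ => (1 / (n : ℝ)) * ∑ l ∈ Finset.range n, B (f^[l] p))
          Filter.atTop (𝓝 L) := by
  obtain ⟨p, L, hL, hp⟩ := exists_point_tendsto f hf B hB h
  obtain ⟨μ, h1, h2, h3⟩ := exists_invariant_of_tendsto f hf B hB p L hp
  refine ⟨⟨μ, h1, h2, h3.symm ▸ hL⟩, p, L, hL, hp.congr fun n => ?_⟩
  simp [birkhoffAverage, birkhoffSum]
end

section
/- Let X be a compact metric space, f : X → X a continuous map, and B : X → ℝ a continuous function. Suppose that every f-invariant Borel probability measure μ on X satisfies ∫ B dμ < 0. Then there exist an integer N ≥ 1 and ε > 0 such that Σ_{ℓ=0}^{N−1} B(f^ℓ(x)) ≤ −εN for every x ∈ X. -/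
open Filter Topology MeasureTheory

lemma empirical_exists {X : Type*} [MetricSpace X] [CompactSpace X]
    [MeasurableSpace X] [BorelSpace X] (f : X → X) (x : X) (n : ℕ) :
    ∃ P : ProbabilityMeasure X, ∀ g : X → ℝ, Continuous g →
      ∫ y, g y ∂(P : Measure X) = ((n : ℝ) + 1)⁻¹ * ∑ l ∈ Finset.range (n + 1), g (f^[l] x) := by
  let m : Measure X :=
    ((n : ENNReal) + 1)⁻¹ • ∑ l ∈ Finset.range (n + 1), Measure.dirac (f^[l] x)
  have hm : IsProbabilityMeasure m := by
    constructor
    simp only [m, Measure.smul_apply, Measure.finset_sum_apply, measure_univ, Finset.sum_const,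
      Finset.card_range, smul_eq_mul, nsmul_eq_mul, mul_one]
    push_cast
    exact ENNReal.inv_mul_cancel (by simp) (by finiteness)
  refine ⟨⟨m, hm⟩, fun g hg => ?_⟩
  simp only [ProbabilityMeasure.coe_mk, m]
  rw [integral_smul_measure, integral_finset_sum_measure]
  · simp only [integral_dirac, smul_eq_mul]
    congr 1
    rw [ENNReal.toReal_inv, ENNReal.toReal_add (by finiteness) (by finiteness)]
    simp
  · intro i _
    exact (BoundedContinuousFunction.mkOfCompact ⟨g, hg⟩).integrable _

/-- Uniform form of the measure-theoretic engine: if every `f`-invariant Borel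
probability measure gives `B` a negative average, then the Birkhoff sums of `B` of
some fixed length `N` are uniformly at most `-εN`. -/
theorem uniform_negative_birkhoff_sums {X : Type*} [MetricSpace X] [CompactSpace X]
    [MeasurableSpace X] [BorelSpace X]
    (f : X → X) (hf : Continuous f) (B : X → ℝ) (hB : Continuous B)
    (h : ∀ μ : Measure X, IsProbabilityMeasure μ →
      (∀ S : Set X, MeasurableSet S → μ (f ⁻¹' S) = μ S) → ∫ x, B x ∂μ < 0) :
    ∃ N : ℕ, 1 ≤ N ∧ ∃ ε > (0 : ℝ), ∀ x : X,
      ∑ l ∈ Finset.range N, B (f^[l] x) ≤ -ε * N := by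
  by_contra! hcon
  have h1 : ∀ n : ℕ, ∃ x : X,
      -((n : ℝ) + 1)⁻¹ * ((n + 1 : ℕ) : ℝ) < ∑ l ∈ Finset.range (n + 1), B (f^[l] x) :=
    fun n => hcon (n + 1) (by omega) _ (by positivity)
  choose x hx using h1
  choose P hP using fun n => empirical_exists f (x n) n
  let U : Ultrafilter ℕ := hyperfilter ℕ
  have hU : (U : Filter ℕ) ≤ atTop := by
    rw [← Nat.cofinite_eq_atTop]; exact hyperfilter_le_cofinite
  obtain ⟨μ, -, hμ⟩ := isCompact_univ.ultrafilter_le_nhds (U.map P) (by simp)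
  have hT : Tendsto P U (𝓝 μ) := hμ
  rw [ProbabilityMeasure.tendsto_iff_forall_integral_tendsto] at hT
  have hT' : ∀ g : X → ℝ, Continuous g → Tendsto (fun n : ℕ =>
      ((n : ℝ) + 1)⁻¹ * ∑ l ∈ Finset.range (n + 1), g (f^[l] (x n))) U
      (𝓝 (∫ y, g y ∂(μ : Measure X))) := by
    intro g hg
    have := hT (BoundedContinuousFunction.mkOfCompact ⟨g, hg⟩)
    simp only [BoundedContinuousFunction.mkOfCompact_apply, ContinuousMap.coe_mk] at this
    exact this.congr fun n => hP n g hg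
  have hinv0 : Tendsto (fun n : ℕ => ((n : ℝ) + 1)⁻¹) U (𝓝 0) := by
    have := tendsto_one_div_add_atTop_nhds_zero_nat (𝕜 := ℝ)
    simp only [one_div] at this
    exact this.mono_left hU
  have hmap : Measure.map f (μ : Measure X) = μ := by
    have : IsProbabilityMeasure (Measure.map f (μ : Measure X)) :=
      Measure.isProbabilityMeasure_map hf.measurable.aemeasurable
    apply ext_of_forall_integral_eq_of_IsFiniteMeasure
    intro g
    rw [integral_map hf.measurable.aemeasurable
      g.continuous.aestronglyMeasurable]
    have ha := (hT' (fun y => g (f y)) (g.continuous.comp hf)).sub (hT' g g.continuous)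
    have hb : Tendsto (fun n : ℕ => ((n : ℝ) + 1)⁻¹ * ∑ l ∈ Finset.range (n + 1),
        g (f (f^[l] (x n))) - ((n : ℝ) + 1)⁻¹ * ∑ l ∈ Finset.range (n + 1), g (f^[l] (x n)))
        U (𝓝 0) := by
      have hc : Tendsto (fun n : ℕ => ((n : ℝ) + 1)⁻¹ * (2 * ‖g‖)) U (𝓝 0) := by
        simpa using hinv0.mul_const (2 * ‖g‖)
      refine squeeze_zero_norm (fun n => ?_) hc
      rw [← mul_sub, ← Finset.sum_sub_distrib]
      have ht := Finset.sum_range_sub (fun l => g (f^[l] (x n))) (n + 1)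
      simp only [Function.iterate_succ_apply'] at ht
      rw [ht, norm_mul, Real.norm_of_nonneg (by positivity : (0:ℝ) ≤ ((n : ℝ) + 1)⁻¹)]
      gcongr
      rw [← dist_eq_norm]
      exact g.dist_le_two_norm _ _
    exact sub_eq_zero.mp (tendsto_nhds_unique ha hb)
  have hneg := h μ inferInstance (fun S hS => by
    rw [← Measure.map_apply hf.measurable hS, hmap])
  have hnn : 0 ≤ ∫ y, B y ∂(μ : Measure X) := by
    have hz : Tendsto (fun n : ℕ => -((n : ℝ) + 1)⁻¹) U (𝓝 0) := by simpa using hinv0.neg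
    refine le_of_tendsto_of_tendsto' hz (hT' B hB) fun n => ?_
    have h2 := hx n
    have hp : (0 : ℝ) < (n : ℝ) + 1 := by positivity
    push_cast at h2
    rw [neg_mul, inv_mul_cancel₀ hp.ne'] at h2
    have := mul_le_mul_of_nonneg_left h2.le (inv_nonneg.2 hp.le)
    linarith
  linarith
end
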